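/- Levin–Schnorr randomness criterion: an infinite binary sequence χ : ℕ → Bool is Martin-Löf random if and only if there exists a constant c such that KP(χ↾n) ≥ n − c for all n, where χ↾n denotes the binary string of the first n bits of χ. -/

import Mathlib

open scoped ENNReal

/-- Prefix complexity of `x` with respect to a prefix decompressor `D`. -/
noncomputable def Kc (D : List Bool →. List Bool) (x : List Bool) : ℕ∞ :=
  sInf {n : ℕ∞ | ∃ p : List Bool, x ∈ D p ∧ (p.length : ℕ∞) = n}

/-- `D` is a prefix function. -/
def PrefixFn (D : List Bool →. List Bool) : Prop :=
  ∀ p q : List Bool, p <+: q → p ≠ q → (D p).Dom → ¬(D q).Dom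

/-- `U` is an optimal prefix decompressor. -/
def OptimalPrefixDecompressor (U : List Bool →. List Bool) : Prop :=
  Partrec U ∧ PrefixFn U ∧
    ∀ D : List Bool →. List Bool, Partrec D → PrefixFn D →
      ∃ c : ℕ, ∀ x : List Bool, Kc U x ≤ Kc D x + (c : ℕ∞)

/-- The interval `Ω_u`. -/
def Cyl (u : List Bool) : Set (ℕ → Bool) :=
  {ω | ∀ i : Fin u.length, ω i = u.get i}

/-- `X` is an effectively null set. -/
def EffNull (X : Set (ℕ → Bool)) : Prop :=
  ∃ u : ℚ × ℕ → List Bool, Computable u ∧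
    ∀ ε : ℚ, 0 < ε →
      (X ⊆ ⋃ i : ℕ, Cyl (u (ε, i))) ∧
      (∑' i : ℕ, (2 : ℝ≥0∞) ^ (-((u (ε, i)).length : ℤ)) ≤
        ENNReal.ofReal (ε : ℝ))

/-- `χ` is Martin-Löf random: it belongs to no effectively null set. -/
def MLRandom (χ : ℕ → Bool) : Prop :=
  ∀ X : Set (ℕ → Bool), EffNull X → χ ∉ X

section RationalCoding

open Encodable

theorem mem_range_rat_encode_iff (y : ℕ) :
    y ∈ Set.range Rat.instEncodable.encode ↔
      0 < y.unpair.2 ∧ ((y.unpair.1 + 1) / 2).Coprime y.unpair.2 := by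
  have encode_eq (q : ℚ) : Rat.instEncodable.encode q = Nat.pair (encode q.num) q.den := rfl
  have natAbs_eq (z : ℤ) : z.natAbs = (encode z + 1) / 2 := by
    cases z with
    | ofNat n =>
      have : encode (Int.ofNat n) = 2 * n := rfl
      rw [this]; simp; omega
    | negSucc n =>
      have : encode (Int.negSucc n) = 2 * n + 1 := rfl
      rw [this]; simp; omega
  constructor
  · rintro ⟨q, rfl⟩
    rw [encode_eq, Nat.unpair_pair, ← natAbs_eq]
    exact ⟨q.pos, q.reduced⟩
  · rintro ⟨h0, hc⟩
    obtain ⟨z, -, hz⟩ := Denumerable.decode_inv (α := ℤ) y.unpair.1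
    replace hz : encode z = y.unpair.1 := hz
    rw [← hz, ← natAbs_eq] at hc
    refine ⟨⟨z, y.unpair.2, h0.ne', hc⟩, ?_⟩
    rw [encode_eq, hz, Nat.pair_unpair]

open Classical in
theorem rat_encode_eq_card (q : ℚ) :
    Rat.instDenumerable.toEncodable.encode q =
      ((Finset.range (Nat.pair (encode q.num) q.den)).filter
      (fun y => y ∈ Set.range Rat.instEncodable.encode)).card := by
  have h : Rat.instDenumerable.toEncodable.encode q =
      letI := @decidableRangeEncode ℚ Rat.instEncodable
      (List.range (Rat.instEncodable.encode q)).countP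
        (fun y => y ∈ Set.range Rat.instEncodable.encode) := rfl
  refine h.trans ?_
  rw [List.countP_eq_length_filter]
  simp [Finset.card, Finset.filter]
  rfl

/-- A bound for the denominator of a rational that is primitive recursive in its code. -/
theorem rat_den_le (q : ℚ) :
    q.den ≤ Nat.pair (Rat.instDenumerable.toEncodable.encode q + 1) 1 := by
  classical
  refine (Nat.right_le_pair (encode q.num) q.den).trans ?_
  by_contra! h
  have hsub : (Finset.range (Rat.instDenumerable.toEncodable.encode q + 1)).image
      (fun a => Nat.pair a 1) ⊆
      (Finset.range (Nat.pair (encode q.num) q.den)).filter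
        (fun y => y ∈ Set.range Rat.instEncodable.encode) := by
    intro y hy
    obtain ⟨a, ha, rfl⟩ := Finset.mem_image.1 hy
    rw [Finset.mem_range] at ha
    simp only [Finset.mem_filter, Finset.mem_range, mem_range_rat_encode_iff, Nat.unpair_pair]
    exact ⟨(Nat.pair_lt_pair_left 1 ha).trans h, by simp⟩
  have hcard := Finset.card_le_card hsub
  rw [← rat_encode_eq_card, Finset.card_image_of_injective _
    (fun a b hab => (Nat.pair_eq_pair.1 hab).1), Finset.card_range] at hcard
  omega

theorem primrec_two_pow : Primrec (fun k : ℕ => 2 ^ k) := by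
  refine (Primrec.nat_rec₁ 1
    (Primrec.nat_double.comp (Primrec.snd (α := ℕ) (β := ℕ))).to₂).of_eq fun k => ?_
  induction k with
  | zero => rfl
  | succ k ih =>
    change 2 * (Nat.rec 1 _ k : ℕ) = _
    rw [ih, pow_succ, mul_comm]

theorem primrecRel_dvd : PrimrecRel (fun a b : ℕ => a ∣ b) :=
  (Primrec.eq.comp (Primrec.nat_mod.comp Primrec.snd Primrec.fst) (Primrec.const 0)).of_eq
    fun _ => (Nat.dvd_iff_mod_eq_zero).symm

theorem primrecRel_coprime : PrimrecRel Nat.Coprime := by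
  have h : PrimrecRel fun (d : ℕ) (p : ℕ × ℕ) => ¬(d ∣ p.1 ∧ d ∣ p.2 ∧ d ≠ 1) := by
    refine PrimrecPred.not (PrimrecPred.and ?_ (PrimrecPred.and ?_ (PrimrecPred.not ?_)))
    · exact primrecRel_dvd.comp Primrec.fst (Primrec.fst.comp Primrec.snd)
    · exact primrecRel_dvd.comp Primrec.fst (Primrec.snd.comp Primrec.snd)
    · exact Primrec.eq.comp Primrec.fst (Primrec.const 1)
  have h' : PrimrecPred fun p : ℕ × ℕ => ∀ d < p.1 + p.2 + 3, ¬(d ∣ p.1 ∧ d ∣ p.2 ∧ d ≠ 1) := by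
    have hb : Primrec fun p : ℕ × ℕ => p.1 + p.2 + 3 :=
      Primrec.nat_add.comp (Primrec.nat_add.comp Primrec.fst Primrec.snd) (Primrec.const 3)
    exact (h.forall_mem_list.comp (Primrec.list_range.comp hb) Primrec.id).of_eq
      fun p => by simp only [List.mem_range, id]
  refine h'.of_eq fun p => ?_
  constructor
  · intro hd
    by_contra hne
    rcases Nat.eq_zero_or_pos p.1 with h1 | h1
    · rcases Nat.eq_zero_or_pos p.2 with h2 | h2
      · exact hd 2 (by omega) (by simp [h1, h2])
      · exact hd _ (by have := Nat.gcd_le_right p.1 h2; omega)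
          ⟨Nat.gcd_dvd_left _ _, Nat.gcd_dvd_right _ _, hne⟩
    · exact hd _ (by have := Nat.gcd_le_left p.2 h1; omega)
        ⟨Nat.gcd_dvd_left _ _, Nat.gcd_dvd_right _ _, hne⟩
  · rintro hc d - ⟨h1, h2, h3⟩
    exact h3 (Nat.eq_one_of_dvd_coprimes hc h1 h2)

theorem primrecPred_mem_range_rat_encode :
    PrimrecPred fun y : ℕ => y ∈ Set.range Rat.instEncodable.encode := by
  refine PrimrecPred.of_eq (PrimrecPred.and (Primrec.nat_lt.comp (Primrec.const 0) ?_)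
    (primrecRel_coprime.comp ?_ ?_)) fun y => (mem_range_rat_encode_iff y).symm
  · exact Primrec.snd.comp Primrec.unpair
  · exact Primrec.nat_div.comp (Primrec.succ.comp (Primrec.fst.comp Primrec.unpair))
      (Primrec.const 2)
  · exact Primrec.snd.comp Primrec.unpair

theorem primrec_rat_two_pow_inv : Primrec (fun k : ℕ => ((2 ^ k : ℕ) : ℚ)⁻¹) := by
  classical
  rw [← Primrec.encode_iff]
  have hcount := Primrec.list_length.comp
    ((Primrec.listFilter primrecPred_mem_range_rat_encode).comp
    (Primrec.list_range.comp (Primrec₂.natPair.comp (Primrec.const (encode (1 : ℤ)))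
      primrec_two_pow)))
  refine hcount.of_eq fun k => ?_
  refine Eq.trans ?_ (rat_encode_eq_card _).symm
  have hnum : (((2 ^ k : ℕ) : ℚ)⁻¹).num = 1 :=
    Rat.inv_natCast_num_of_pos (by positivity)
  have hden : (((2 ^ k : ℕ) : ℚ)⁻¹).den = 2 ^ k :=
    Rat.inv_natCast_den_of_pos (by positivity)
  rw [hnum, hden]
  simp [Finset.card, Finset.filter]
  rfl

end RationalCoding

section PrefixFunctions

open Encodable

/-- **Kraft's inequality** for the domain of a prefix function. -/
theorem PrefixFn.tsum_le_one {D : List Bool →. List Bool} (hD : PrefixFn D) :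
    ∑' p : {p : List Bool // (D p).Dom}, (2⁻¹ : ℝ≥0∞) ^ p.1.length ≤ 1 := by
  classical
  rw [ENNReal.tsum_eq_iSup_sum]
  refine iSup_le fun s => ?_
  by_cases hnil : (D []).Dom
  · have hsub : s ⊆ {⟨[], hnil⟩} := by
      rintro ⟨p, hp⟩ -
      by_cases h : p = []
      · subst h; simp
      · exact absurd hp (hD [] p ⟨p, rfl⟩ (Ne.symm h) hnil)
    exact (Finset.sum_le_sum_of_subset hsub).trans (by simp)
  · have hud : InformationTheory.UniquelyDecodable
        ((s.map (Function.Embedding.subtype _) : Finset (List Bool)) : Set (List Bool)) := by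
      have hdom : ∀ w ∈ ((s.map (Function.Embedding.subtype _) : Finset (List Bool)) :
          Set (List Bool)), (D w).Dom := by
        intro w hw
        simp only [Finset.coe_map, Set.mem_image] at hw
        obtain ⟨p, -, rfl⟩ := hw
        exact p.2
      intro L₁
      induction L₁ with
      | nil =>
        intro L₂ _ h₂ hf
        cases L₂ with
        | nil => rfl
        | cons q L₂ =>
          have hq := hdom q (h₂ q (by simp))
          have : q = [] := by simp_all
          exact absurd (this ▸ hq) hnil
      | cons p L₁ ih =>
        intro L₂ h₁ h₂ hf
        have hp := hdom p (h₁ p (by simp))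
        cases L₂ with
        | nil =>
          have : p = [] := by simp_all
          exact absurd (this ▸ hp) hnil
        | cons q L₂ =>
          have hq := hdom q (h₂ q (by simp))
          simp only [List.flatten_cons] at hf
          have hpq : p = q := by
            by_contra hne
            have h₁ : p <+: p ++ L₁.flatten := List.prefix_append p _
            have h₂ : q <+: p ++ L₁.flatten := hf ▸ List.prefix_append q _
            rcases le_total p.length q.length with h | h
            · exact hD p q (List.prefix_of_prefix_length_le h₁ h₂ h) hne hp hq
            · exact hD q p (List.prefix_of_prefix_length_le h₂ h₁ h) (Ne.symm hne) hq hp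
          subst hpq
          rw [ih L₂ (fun w hw => h₁ w (List.mem_cons_of_mem _ hw))
            (fun w hw => h₂ w (List.mem_cons_of_mem _ hw)) (List.append_cancel_left hf)]
    have hk := InformationTheory.kraft_mcmillan_inequality hud
    rw [Finset.sum_map] at hk
    have := ENNReal.ofReal_le_ofReal hk
    rw [ENNReal.ofReal_sum_of_nonneg (fun _ _ => by positivity)] at this
    simpa [ENNReal.ofReal_pow, ENNReal.ofReal_inv_of_pos, ENNReal.inv_pow] using this

theorem Kc_lt_iff {D : List Bool →. List Bool} {x : List Bool} {m : ℕ} :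
    Kc D x < m ↔ ∃ p, x ∈ D p ∧ p.length < m := by
  rw [Kc, sInf_lt_iff]
  constructor
  · rintro ⟨_, ⟨p, hp, rfl⟩, h⟩
    exact ⟨p, hp, by exact_mod_cast h⟩
  · rintro ⟨p, hp, h⟩
    exact ⟨_, ⟨p, hp, rfl⟩, by exact_mod_cast h⟩

theorem Kc_le_length {D : List Bool →. List Bool} {x p : List Bool} (h : x ∈ D p) :
    Kc D x ≤ p.length :=
  sInf_le ⟨p, h, rfl⟩

theorem two_zpow_neg_natCast (n : ℕ) : (2 : ℝ≥0∞) ^ (-(n : ℤ)) = 2⁻¹ ^ n := by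
  rw [ENNReal.zpow_neg, zpow_natCast, ENNReal.inv_pow]

theorem mem_Cyl_iff {u : List Bool} {χ : ℕ → Bool} :
    χ ∈ Cyl u ↔ (List.range u.length).map χ = u := by
  constructor
  · intro h
    refine List.ext_getElem (by simp) fun i h₁ h₂ => ?_
    simpa using h ⟨i, h₂⟩
  · intro h i
    have := List.getElem_of_eq h.symm i.2
    simpa using this.symm

/-- The graph of a partial computable function can be enumerated without repetitions. -/
theorem exists_graph_enumeration {α β : Type*} [Primcodable α] [Primcodable β]
    {f : α →. β} (hf : Partrec f) :
    ∃ e : ℕ → Option (α × β), Computable e ∧ (∀ a b, b ∈ f a ↔ ∃ n, e n = some (a, b)) ∧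
      ∀ m n a b b', e m = some (a, b) → e n = some (a, b') → m = n := by
  classical
  obtain ⟨c, hc⟩ := Nat.Partrec.Code.exists_code.1 hf
  have heval (a : α) (b : β) : b ∈ f a ↔ ∃ y ∈ c.eval (encode a), decode y = some b := by
    rw [hc]
    simp only [encodek, Part.coe_some, Part.bind_some, Part.mem_map_iff]
    constructor
    · intro h
      exact ⟨_, ⟨b, h, rfl⟩, encodek b⟩
    · rintro ⟨_, ⟨b', h, rfl⟩, h'⟩
      rw [encodek, Option.some_inj] at h'
      exact h' ▸ h
  let e : ℕ → Option (α × β) := fun n =>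
    (decode n.unpair.1 : Option α).bind fun a =>
      if encode a = n.unpair.1 ∧ c.evaln n.unpair.2 n.unpair.1 = none then
        (c.evaln (n.unpair.2 + 1) n.unpair.1).bind fun y =>
          (decode y : Option β).map fun b => (a, b)
      else none
  have he : Primrec e := by
    have h1 : Primrec fun n : ℕ => n.unpair.1 := Primrec.fst.comp Primrec.unpair
    have h2 : Primrec fun n : ℕ => n.unpair.2 := Primrec.snd.comp Primrec.unpair
    refine Primrec.option_bind (Primrec.decode.comp h1) (Primrec.ite (PrimrecPred.and ?_ ?_) ?_
      (Primrec.const none))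
    · exact Primrec.eq.comp (Primrec.encode.comp Primrec.snd) (h1.comp Primrec.fst)
    · refine Primrec.eq.comp ?_ (Primrec.const none)
      exact Nat.Partrec.Code.primrec_evaln.comp
        (((h2.comp Primrec.fst).pair (Primrec.const c)).pair (h1.comp Primrec.fst))
    · refine Primrec.option_bind (Nat.Partrec.Code.primrec_evaln.comp
        ((((Primrec.succ.comp h2).comp Primrec.fst).pair (Primrec.const c)).pair
          (h1.comp Primrec.fst))) ?_
      refine Primrec.option_map (Primrec.decode.comp Primrec.snd) ?_
      exact Primrec.pair (Primrec.snd.comp (Primrec.fst.comp Primrec.fst)) Primrec.snd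
  have he_iff (n : ℕ) (a : α) (b : β) : e n = some (a, b) ↔
      encode a = n.unpair.1 ∧ c.evaln n.unpair.2 n.unpair.1 = none ∧
        ∃ y, c.evaln (n.unpair.2 + 1) n.unpair.1 = some y ∧ decode y = some b := by
    simp only [e, Option.bind_eq_some_iff]
    constructor
    · rintro ⟨a', -, h⟩
      split_ifs at h with hif
      obtain ⟨y, hy, hb⟩ := Option.bind_eq_some_iff.1 h
      obtain ⟨b', hb', heq⟩ := Option.map_eq_some_iff.1 hb
      obtain ⟨rfl, rfl⟩ := Prod.mk.inj heq
      exact ⟨hif.1, hif.2, y, hy, hb'⟩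
    · rintro ⟨h1, h2, y, hy, hb⟩
      refine ⟨a, by rw [← h1, encodek], ?_⟩
      rw [if_pos ⟨h1, h2⟩, hy]
      simp [hb]
  refine ⟨e, he.to_comp, fun a b => ?_, fun m n a b b' hm hn => ?_⟩
  · rw [heval]
    constructor
    · rintro ⟨y, hy, hb⟩
      have hex := Nat.Partrec.Code.evaln_complete.1 hy
      have hpos : Nat.find hex ≠ 0 := by
        intro h0
        have := Nat.find_spec hex
        rw [h0] at this
        simp [Nat.Partrec.Code.evaln] at this
      obtain ⟨s, hs⟩ := Nat.exists_eq_succ_of_ne_zero hpos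
      refine ⟨Nat.pair (encode a) s, (he_iff _ _ _).2 ?_⟩
      rw [Nat.unpair_pair]
      refine ⟨rfl, ?_, y, by rw [← Nat.succ_eq_add_one, ← hs]; exact Nat.find_spec hex, hb⟩
      by_contra hne
      obtain ⟨z, hz⟩ := Option.ne_none_iff_exists'.1 hne
      have hzy : z = y := Part.mem_unique (Nat.Partrec.Code.evaln_sound hz) hy
      exact Nat.find_min hex (m := s) (by omega) (hzy ▸ hz)
    · rintro ⟨n, hn⟩
      obtain ⟨h1, -, y, hy, hb⟩ := (he_iff _ _ _).1 hn
      exact ⟨y, h1 ▸ Nat.Partrec.Code.evaln_sound hy, hb⟩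
  · obtain ⟨hm1, hm2, y, hy, -⟩ := (he_iff _ _ _).1 hm
    obtain ⟨hn1, hn2, z, hz, -⟩ := (he_iff _ _ _).1 hn
    rw [← hm1] at hm2 hy
    rw [← hn1] at hn2 hz
    have hsnd : m.unpair.2 = n.unpair.2 := by
      rcases lt_trichotomy m.unpair.2 n.unpair.2 with h | h | h
      · have := Nat.Partrec.Code.evaln_mono (Nat.succ_le_of_lt h) hy
        simp [hn2] at this
      · exact h
      · have := Nat.Partrec.Code.evaln_mono (Nat.succ_le_of_lt h) hz
        simp [hm2] at this
    rw [← Nat.pair_unpair m, ← Nat.pair_unpair n, ← hm1, ← hn1, hsnd]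

end PrefixFunctions

section KraftCodes

/-- The number with binary expansion `p`, most significant bit first. -/
def binValue (p : List Bool) : ℕ :=
  p.foldl (fun v b => 2 * v + cond b 1 0) 0

theorem primrec_binValue : Primrec binValue :=
  Primrec.list_foldl Primrec.id (Primrec.const 0) (Primrec.nat_add.comp
    (Primrec.nat_double.comp (Primrec.fst.comp Primrec.snd))
    (Primrec.cond (Primrec.snd.comp Primrec.snd) (Primrec.const 1) (Primrec.const 0))).to₂

theorem binValue_concat (p : List Bool) (b : Bool) :
    binValue (p ++ [b]) = 2 * binValue p + cond b 1 0 := by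
  simp [binValue]

theorem binValue_append_bounds (p r : List Bool) :
    binValue p * 2 ^ r.length ≤ binValue (p ++ r) ∧
      binValue (p ++ r) < (binValue p + 1) * 2 ^ r.length := by
  induction r using List.reverseRecOn with
  | nil => simp
  | append_singleton r b ih =>
    rw [← List.append_assoc, binValue_concat, List.length_append, List.length_singleton, pow_succ,
      ← mul_assoc, ← mul_assoc]
    obtain ⟨h₁, h₂⟩ := ih
    cases b <;> simp only [cond_true, cond_false] <;> omega

theorem exists_binValue_eq (n a : ℕ) (h : a < 2 ^ n) :
    ∃ p : List Bool, p.length = n ∧ binValue p = a := by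
  induction n generalizing a with
  | zero => exact ⟨[], rfl, by simp at h; simp [binValue, h]⟩
  | succ n ih =>
    obtain ⟨p, hp, hv⟩ := ih (a / 2) (by rw [pow_succ] at h; omega)
    refine ⟨p ++ [decide (a % 2 = 1)], by simp [hp], ?_⟩
    rw [binValue_concat, hv]
    by_cases h1 : a % 2 = 1
    · simp [h1]; omega
    · simp [h1]; omega

/-- A pair `(m, t)` such that the sum of `2⁻¹ ^ n i` over `i < j` is `t / 2 ^ m`. -/
def kraftSum (n : ℕ → ℕ) : ℕ → ℕ × ℕ
  | 0 => (0, 0)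
  | j + 1 => ((kraftSum n j).1 + n j, (kraftSum n j).2 * 2 ^ n j + 2 ^ (kraftSum n j).1)

/-- The position of the dyadic interval of length `2⁻¹ ^ n j` reserved for the `j`-th request. -/
def kraftCode (n : ℕ → ℕ) (j : ℕ) : ℕ :=
  2 * (kraftSum n j).2 * 2 ^ n j / 2 ^ (kraftSum n j).1 + 1

theorem computable_kraftSum {n : ℕ → ℕ} (hn : Computable n) : Computable (kraftSum n) := by
  have hpow : Computable fun k : ℕ => 2 ^ k := primrec_two_pow.to_comp
  have hadd := Primrec.nat_add.to_comp
  have hmul := Primrec.nat_mul.to_comp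
  have hstep : Computable fun p : ℕ × (ℕ × ℕ) =>
      (p.2.1 + n p.1, p.2.2 * 2 ^ n p.1 + 2 ^ p.2.1) := by
    have h1 : Computable fun p : ℕ × (ℕ × ℕ) => n p.1 := hn.comp Computable.fst
    have h2 : Computable fun p : ℕ × (ℕ × ℕ) => p.2.1 := Computable.fst.comp Computable.snd
    have h3 : Computable fun p : ℕ × (ℕ × ℕ) => p.2.2 := Computable.snd.comp Computable.snd
    exact (hadd.comp h2 h1).pair (hadd.comp (hmul.comp h3 (hpow.comp h1)) (hpow.comp h2))
  refine (Computable.nat_rec (h := fun _ (p : ℕ × (ℕ × ℕ)) =>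
      (p.2.1 + n p.1, p.2.2 * 2 ^ n p.1 + 2 ^ p.2.1)) Computable.id
    (Computable.const ((0, 0) : ℕ × ℕ)) (hstep.comp Computable.snd).to₂).of_eq fun j => ?_
  induction j with
  | zero => rfl
  | succ j ih =>
    simp only [id] at ih ⊢
    rw [ih]
    rfl

theorem computable_kraftCode {n : ℕ → ℕ} (hn : Computable n) : Computable (kraftCode n) := by
  have hpow : Computable fun k : ℕ => 2 ^ k := primrec_two_pow.to_comp
  have hs := computable_kraftSum hn
  exact Computable.succ.comp (Primrec.nat_div.to_comp.comp
    (Primrec.nat_mul.to_comp.comp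
      (Primrec.nat_double.to_comp.comp (Computable.snd.comp hs)) (hpow.comp hn))
    (hpow.comp (Computable.fst.comp hs)))

theorem kraftSum_eq_sum (n : ℕ → ℕ) (j : ℕ) :
    ((kraftSum n j).2 : ℝ) / 2 ^ (kraftSum n j).1 = ∑ i ∈ Finset.range j, (2⁻¹ : ℝ) ^ n i := by
  induction j with
  | zero => simp [kraftSum]
  | succ j ih =>
    rw [Finset.sum_range_succ, ← ih, kraftSum]
    push_cast
    rw [pow_add, inv_pow]
    field_simp

theorem kraftCode_bounds (n : ℕ → ℕ) (j : ℕ) :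
    2 * ∑ i ∈ Finset.range j, (2⁻¹ : ℝ) ^ n i ≤ kraftCode n j / 2 ^ n j ∧
      (kraftCode n j + 1 : ℝ) / 2 ^ n j ≤ 2 * ∑ i ∈ Finset.range (j + 1), (2⁻¹ : ℝ) ^ n i := by
  have hfloor : ((kraftCode n j : ℝ) - 1) * 2 ^ (kraftSum n j).1 ≤
      2 * (kraftSum n j).2 * 2 ^ n j := by
    have := Nat.div_mul_le_self (2 * (kraftSum n j).2 * 2 ^ n j) (2 ^ (kraftSum n j).1)
    rw [kraftCode]
    push_cast
    rw [add_sub_cancel_right]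
    exact_mod_cast this
  have hceil : (2 * (kraftSum n j).2 * 2 ^ n j : ℝ) ≤
      kraftCode n j * 2 ^ (kraftSum n j).1 := by
    have := Nat.lt_succ_iff.1 (Nat.lt_succ_of_lt (Nat.lt_div_mul_add
      (a := 2 * (kraftSum n j).2 * 2 ^ n j) (b := 2 ^ (kraftSum n j).1) (by positivity)))
    rw [← Nat.succ_mul] at this
    exact_mod_cast this
  rw [Finset.sum_range_succ, ← kraftSum_eq_sum, inv_pow]
  constructor
  · rw [← mul_div_assoc, div_le_div_iff₀ (by positivity) (by positivity)]
    exact hceil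
  · have h1 : (kraftCode n j - 1 : ℝ) / 2 ^ n j ≤
        2 * ((kraftSum n j).2 / 2 ^ (kraftSum n j).1) := by
      rw [← mul_div_assoc, div_le_div_iff₀ (by positivity) (by positivity)]
      exact hfloor
    have h2 : (kraftCode n j + 1 : ℝ) / 2 ^ n j =
        (kraftCode n j - 1) / 2 ^ n j + 2 * (2 ^ n j)⁻¹ := by
      field_simp
      ring
    rw [h2]
    linarith

theorem kraftCode_prefix_le {n : ℕ → ℕ} {i j : ℕ} {p q : List Bool} (hpq : p <+: q)
    (hp : p.length = n i) (hq : q.length = n j) (hpv : binValue p = kraftCode n i)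
    (hqv : binValue q = kraftCode n j) : i = j := by
  obtain ⟨r, rfl⟩ := hpq
  obtain ⟨h₁, h₂⟩ := binValue_append_bounds p r
  rw [hpv, hqv] at h₁ h₂
  have hlen : (2 : ℝ) ^ n j = 2 ^ n i * 2 ^ r.length := by
    rw [← hq, List.length_append, pow_add, hp]
  have h₁' : (kraftCode n i : ℝ) / 2 ^ n i ≤ kraftCode n j / 2 ^ n j := by
    rw [hlen, ← mul_div_mul_right _ _ (by positivity : (2 : ℝ) ^ r.length ≠ 0)]
    gcongr
    exact_mod_cast h₁
  have h₂' : (kraftCode n j : ℝ) / 2 ^ n j < (kraftCode n i + 1) / 2 ^ n i := by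
    rw [hlen, ← mul_div_mul_right (_ + 1) _ (by positivity : (2 : ℝ) ^ r.length ≠ 0)]
    gcongr
    exact_mod_cast h₂
  have hmono : Monotone fun k => ∑ i ∈ Finset.range k, (2⁻¹ : ℝ) ^ n i :=
    fun a b hab => Finset.sum_le_sum_of_subset_of_nonneg (Finset.range_mono hab)
      fun _ _ _ => by positivity
  have hi := kraftCode_bounds n i
  have hj := kraftCode_bounds n j
  have hjpos : (kraftCode n j : ℝ) / 2 ^ n j < (kraftCode n j + 1) / 2 ^ n j := by
    gcongr
    linarith
  rcases lt_trichotomy i j with h | h | h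
  · have := hmono (Nat.succ_le_of_lt h)
    simp only [Nat.succ_eq_add_one] at this
    linarith [hi.2, hj.1]
  · exact h
  · have := hmono (Nat.succ_le_of_lt h)
    simp only [Nat.succ_eq_add_one] at this
    linarith [hi.1, hj.2]

/-- A computable sequence of requests `(x j, n j)` with `∑ 2⁻¹ ^ n j ≤ 1 / 2` is served by some
prefix decompressor. -/
theorem exists_prefixFn_of_requests {x : ℕ → List Bool} {n : ℕ → ℕ} (hx : Computable x)
    (hn : Computable n) (hsum : ∑' j, (2⁻¹ : ℝ≥0∞) ^ n j ≤ 2⁻¹) :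
    ∃ D : List Bool →. List Bool, Partrec D ∧ PrefixFn D ∧ ∀ j, Kc D (x j) ≤ n j := by
  let test : List Bool → ℕ → Bool := fun p j =>
    decide (p.length = n j ∧ binValue p = kraftCode n j)
  have htest : Computable₂ test := by
    have heq : Computable₂ fun a b : ℕ => decide (a = b) := Primrec.eq.decide.to_comp
    have hand : Computable₂ and := Primrec.and.to_comp
    refine (hand.comp
      (heq.comp (Computable.list_length.comp Computable.fst) (hn.comp Computable.snd))
      (heq.comp (primrec_binValue.to_comp.comp Computable.fst)
        ((computable_kraftCode hn).comp Computable.snd))).of_eq fun p => ?_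
    simp [test]
  let D : List Bool →. List Bool := fun p => (Nat.rfind fun j => Part.some (test p j)).map x
  have hD : Partrec D :=
    Partrec.map (Partrec.rfind htest.partrec₂) (hx.comp Computable.snd).to₂
  have hspec {p : List Bool} {j : ℕ} (h : j ∈ Nat.rfind fun j => Part.some (test p j)) :
      p.length = n j ∧ binValue p = kraftCode n j := by
    simpa [test] using Nat.rfind_spec h
  refine ⟨D, hD, fun p q hpq hne hp hq => hne ?_, fun j => ?_⟩
  · obtain ⟨i, hi⟩ := Part.dom_iff_mem.1 (show (Nat.rfind fun j => Part.some (test p j)).Dom from hp)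
    obtain ⟨j, hj⟩ := Part.dom_iff_mem.1 (show (Nat.rfind fun j => Part.some (test q j)).Dom from hq)
    have hi := hspec hi
    have hj := hspec hj
    have hij := kraftCode_prefix_le hpq hi.1 hj.1 hi.2 hj.2
    exact hpq.eq_of_length (by rw [hi.1, hj.1, hij])
  · have hcode : kraftCode n j < 2 ^ n j := by
      have hle : ∑ i ∈ Finset.range (j + 1), (2⁻¹ : ℝ) ^ n i ≤ 2⁻¹ := by
        have h := (ENNReal.sum_le_tsum (Finset.range (j + 1))).trans hsum
        have h' := ENNReal.toReal_mono (by simp) h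
        rw [ENNReal.toReal_sum (by simp)] at h'
        simpa using h'
      have h := (kraftCode_bounds n j).2
      have h1 : (kraftCode n j + 1 : ℝ) / 2 ^ n j ≤ 1 := by linarith
      rw [div_le_one (by positivity)] at h1
      exact_mod_cast h1
    obtain ⟨p, hp, hv⟩ := exists_binValue_eq _ _ hcode
    have hdom : (Nat.rfind fun j => Part.some (test p j)).Dom :=
      Nat.rfind_dom.2 ⟨j, by simp [test, hp, hv], by simp⟩
    obtain ⟨i, hi⟩ := Part.dom_iff_mem.1 hdom
    have hij : i = j :=
      kraftCode_prefix_le (List.prefix_refl p) (hspec hi).1 hp (hspec hi).2 hv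
    subst hij
    exact hp ▸ Kc_le_length (Part.mem_map x hi)

end KraftCodes

section Criterion

open Encodable

theorem two_inv_pow_le_ofReal_rat {ε : ℚ} (hε : 0 < ε) {k : ℕ} (hk : ε.den ≤ k) :
    (2⁻¹ : ℝ≥0∞) ^ k ≤ ENNReal.ofReal (ε : ℝ) := by
  have h2 : (2⁻¹ : ℝ≥0∞) ^ k = ENNReal.ofReal ((2⁻¹ : ℝ) ^ k) := by
    rw [ENNReal.ofReal_pow (by norm_num), ENNReal.ofReal_inv_of_pos (by norm_num)]
    simp
  rw [h2]
  refine ENNReal.ofReal_le_ofReal ?_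
  have hden : (0 : ℝ) < ε.den := by exact_mod_cast ε.pos
  have hnum : (1 : ℝ) ≤ ε.num := by exact_mod_cast Rat.num_pos.2 hε
  have hpow : (ε.den : ℝ) ≤ 2 ^ k := by exact_mod_cast hk.trans k.lt_two_pow_self.le
  rw [inv_pow, Rat.cast_def]
  calc ((2 : ℝ) ^ k)⁻¹ ≤ (ε.den : ℝ)⁻¹ := inv_anti₀ hden hpow
    _ = 1 / ε.den := (one_div _).symm
    _ ≤ ε.num / ε.den := by gcongr

/-- If the prefixes of `χ` can be compressed by arbitrarily many bits,
then `χ` is covered by an effectively null set. -/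
theorem effNull_singleton_of_compressible {U : List Bool →. List Bool} (hU : Partrec U)
    (hpre : PrefixFn U) {χ : ℕ → Bool}
    (h : ∀ c : ℕ, ∃ n p, (List.range n).map χ ∈ U p ∧ p.length + c ≤ n) : EffNull {χ} := by
  obtain ⟨e, he, hmem, hinj⟩ := exists_graph_enumeration hU
  let K : ℚ → ℕ := fun ε =>
    Nat.pair (Rat.instDenumerable.toEncodable.encode ε + 1) 1 + 1
  have hK : Primrec K := Primrec.succ.comp
    (Primrec₂.natPair.comp (Primrec.succ.comp Primrec.encode) (Primrec.const 1))
  let sel : ℕ → List Bool × List Bool → Option (List Bool) := fun k a =>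
    if a.1.length + k ≤ a.2.length then some a.2 else none
  have hsel : Primrec₂ sel := by
    have h1 : Primrec fun a : ℕ × (List Bool × List Bool) => a.2.1.length + a.1 :=
      Primrec.nat_add.comp (Primrec.list_length.comp (Primrec.fst.comp Primrec.snd)) Primrec.fst
    have h2 : Primrec fun a : ℕ × (List Bool × List Bool) => a.2.2 :=
      Primrec.snd.comp Primrec.snd
    exact Primrec.ite (Primrec.nat_le.comp h1 (Primrec.list_length.comp h2))
      (Primrec.option_some.comp h2) (Primrec.const none)
  let pad : ℕ → List Bool := fun m => (List.range m).map fun _ => false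
  have hpad : Primrec pad := Primrec.list_map Primrec.list_range (Primrec.const false).to₂
  let u : ℚ × ℕ → List Bool := fun a =>
    ((e a.2).bind (sel (K a.1))).getD (pad (K a.1 + (a.2 + 1)))
  have hu : Computable u := by
    refine Computable.option_getD (Computable.option_bind (he.comp Computable.snd) ?_) ?_
    · exact hsel.to_comp.comp (hK.to_comp.comp (Computable.fst.comp Computable.fst))
        Computable.snd
    · exact (hpad.comp (Primrec.nat_add.comp (hK.comp Primrec.fst)
        (Primrec.succ.comp Primrec.snd))).to_comp
  let wt : ℕ → ℝ≥0∞ := fun i => (e i).elim 0 fun a => 2⁻¹ ^ a.1.length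
  have hwt : ∑' i, wt i ≤ 1 := by
    let S : Set ℕ := {i | (e i).isSome}
    have hS : ∑' i, wt i = ∑' i : S, wt i := by
      refine (tsum_subtype_eq_of_support_subset fun i hi => ?_).symm
      by_contra hn
      have : e i = none := by simpa [S] using hn
      simp [wt, this] at hi
    let f : S → {p : List Bool // (U p).Dom} := fun i =>
      ⟨((e i).get i.2).1, Part.dom_iff_mem.2 ⟨_, (hmem _ _).2 ⟨i, (Option.some_get i.2).symm⟩⟩⟩
    have hf : Function.Injective f := by
      intro i j hij
      have h1 : e i = some (((e i).get i.2).1, ((e i).get i.2).2) := (Option.some_get i.2).symm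
      have h2 : e j = some (((e j).get j.2).1, ((e j).get j.2).2) := (Option.some_get j.2).symm
      rw [← (Subtype.mk.inj hij : ((e i).get i.2).1 = ((e j).get j.2).1)] at h2
      exact Subtype.ext (hinj _ _ _ _ _ h1 h2)
    have hwf : ∀ i : S, wt i = (2⁻¹ : ℝ≥0∞) ^ (f i).1.length := by
      intro i
      obtain ⟨a, ha⟩ := Option.isSome_iff_exists.1 i.2
      simp [wt, f, ha]
    rw [hS]
    simp_rw [hwf]
    exact (ENNReal.tsum_comp_le_tsum_of_injective hf
      fun p : {p : List Bool // (U p).Dom} => (2⁻¹ : ℝ≥0∞) ^ p.1.length).trans hpre.tsum_le_one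
  refine ⟨u, hu, fun ε hε => ⟨?_, ?_⟩⟩
  · refine Set.singleton_subset_iff.2 ?_
    obtain ⟨n, p, hp, hlen⟩ := h (K ε)
    obtain ⟨i, hi⟩ := (hmem _ _).1 hp
    have hui : u (ε, i) = (List.range n).map χ := by
      simp [u, sel, hi, hlen]
    refine Set.mem_iUnion.2 ⟨i, mem_Cyl_iff.2 ?_⟩
    rw [hui]
    simp
  · have hterm : ∀ i, (2 : ℝ≥0∞) ^ (-((u (ε, i)).length : ℤ)) ≤
        2⁻¹ ^ K ε * wt i + 2⁻¹ ^ K ε * 2⁻¹ ^ (i + 1) := by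
      intro i
      rw [two_zpow_neg_natCast]
      have hpadded (hi : (e i).bind (sel (K ε)) = none) : (2⁻¹ : ℝ≥0∞) ^ (u (ε, i)).length ≤
          2⁻¹ ^ K ε * wt i + 2⁻¹ ^ K ε * 2⁻¹ ^ (i + 1) := by
        refine le_trans (le_of_eq ?_) le_add_self
        simp [u, hi, pad, pow_add]
      rcases hei : e i with _ | a
      · exact hpadded (by simp [hei])
      · by_cases hlen : a.1.length + K ε ≤ a.2.length
        · refine le_trans ?_ le_self_add
          have hui : u (ε, i) = a.2 := by simp [u, sel, hei, hlen]
          have hwi : wt i = 2⁻¹ ^ a.1.length := by simp [wt, hei]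
          rw [hui, hwi, ← pow_add]
          exact pow_le_pow_right_of_le_one' (by simp) (by omega)
        · exact hpadded (by simp [hei, sel, hlen])
    calc ∑' i, (2 : ℝ≥0∞) ^ (-((u (ε, i)).length : ℤ))
        ≤ ∑' i, (2⁻¹ ^ K ε * wt i + 2⁻¹ ^ K ε * 2⁻¹ ^ (i + 1)) := ENNReal.tsum_le_tsum hterm
      _ = 2⁻¹ ^ K ε * ∑' i, wt i + 2⁻¹ ^ K ε := by
        rw [ENNReal.tsum_add, ENNReal.tsum_mul_left, ENNReal.tsum_mul_left,
          ENNReal.tsum_geometric_add_one]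
        simp [ENNReal.inv_mul_cancel]
      _ ≤ 2⁻¹ ^ K ε * 1 + 2⁻¹ ^ K ε := by gcongr
      _ = 2⁻¹ ^ Nat.pair (Rat.instDenumerable.toEncodable.encode ε + 1) 1 := by
        rw [mul_one, ← two_mul, pow_succ', ← mul_assoc,
          ENNReal.mul_inv_cancel (by simp) (by simp), one_mul]
      _ ≤ ENNReal.ofReal (ε : ℝ) := two_inv_pow_le_ofReal_rat hε (rat_den_le ε)

/-- The prefixes of an element of an effectively null set can be compressed by arbitrarily many
bits, by a single prefix decompressor. -/
theorem EffNull.exists_compressing_prefixFn {X : Set (ℕ → Bool)} (hX : EffNull X) :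
    ∃ D : List Bool →. List Bool, Partrec D ∧ PrefixFn D ∧
      ∀ χ ∈ X, ∀ k : ℕ, ∃ n : ℕ, k ≤ n ∧ Kc D ((List.range n).map χ) ≤ (n - k : ℕ) := by
  obtain ⟨u, hu, hcover⟩ := hX
  let ε : ℕ → ℚ := fun k => ((2 ^ (2 * k + 2) : ℕ) : ℚ)⁻¹
  have hε (k : ℕ) : 0 < ε k := by positivity
  have hofReal (k : ℕ) : ENNReal.ofReal (ε k : ℝ) = 2⁻¹ ^ (2 * k + 2) := by
    simp only [ε]
    push_cast
    rw [← inv_pow, ENNReal.ofReal_pow (by norm_num), ENNReal.ofReal_inv_of_pos (by norm_num)]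
    simp
  have hlen (k i : ℕ) : 2 * k + 2 ≤ (u (ε k, i)).length := by
    have h := (ENNReal.le_tsum i).trans (hcover (ε k) (hε k)).2
    rw [hofReal, two_zpow_neg_natCast] at h
    by_contra! hlt
    refine absurd h (not_le.2 ?_)
    rw [← ENNReal.inv_pow, ← ENNReal.inv_pow, ENNReal.inv_lt_inv]
    exact_mod_cast Nat.pow_lt_pow_right (by norm_num) hlt
  let x : ℕ → List Bool := fun j => u (ε j.unpair.1, j.unpair.2)
  let n : ℕ → ℕ := fun j => (x j).length - j.unpair.1
  have hx : Computable x := by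
    have h1 : Primrec fun j : ℕ => ε j.unpair.1 := primrec_rat_two_pow_inv.comp
      (Primrec.succ.comp (Primrec.succ.comp
        (Primrec.nat_double.comp (Primrec.fst.comp Primrec.unpair))))
    exact hu.comp (h1.pair (Primrec.snd.comp Primrec.unpair)).to_comp
  have hn : Computable n := Primrec.nat_sub.to_comp.comp (Computable.list_length.comp hx)
    (Primrec.fst.comp Primrec.unpair).to_comp
  have hsum : ∑' j, (2⁻¹ : ℝ≥0∞) ^ n j ≤ 2⁻¹ := by
    have hsplit (k i : ℕ) : (2⁻¹ : ℝ≥0∞) ^ n (Nat.pair k i) =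
        2 ^ k * 2 ^ (-((u (ε k, i)).length : ℤ)) := by
      have hk : k ≤ (u (ε k, i)).length := by have := hlen k i; omega
      obtain ⟨m, hm⟩ := Nat.exists_eq_add_of_le hk
      have hnm : n (Nat.pair k i) = m := by simp [n, x, hm]
      rw [two_zpow_neg_natCast, hm, hnm, pow_add, ← mul_assoc, ← mul_pow,
        ENNReal.mul_inv_cancel (by simp) (by simp), one_pow, one_mul]
    calc ∑' j, (2⁻¹ : ℝ≥0∞) ^ n j
        = ∑' p : ℕ × ℕ, (2⁻¹ : ℝ≥0∞) ^ n (Nat.pairEquiv p) :=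
          (Equiv.tsum_eq Nat.pairEquiv fun j => (2⁻¹ : ℝ≥0∞) ^ n j).symm
      _ = ∑' k, ∑' i, (2⁻¹ : ℝ≥0∞) ^ n (Nat.pair k i) := ENNReal.tsum_prod'
      _ = ∑' k, 2 ^ k * ∑' i, (2 : ℝ≥0∞) ^ (-((u (ε k, i)).length : ℤ)) := by
          simp_rw [hsplit, ENNReal.tsum_mul_left]
      _ ≤ ∑' k, 2 ^ k * (2⁻¹ : ℝ≥0∞) ^ (2 * k + 2) := by
          refine ENNReal.tsum_le_tsum fun k => ?_
          rw [← hofReal]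
          gcongr
          exact (hcover (ε k) (hε k)).2
      _ = ∑' k, 2⁻¹ * (2⁻¹ : ℝ≥0∞) ^ (k + 1) := by
          congr 1 with k
          rw [show 2 * k + 2 = k + (k + 2) by ring, pow_add, ← mul_assoc, ← mul_pow,
            ENNReal.mul_inv_cancel (by simp) (by simp), one_pow, one_mul, ← pow_succ']
      _ = 2⁻¹ := by
          rw [ENNReal.tsum_mul_left, ENNReal.tsum_geometric_add_one]
          simp [ENNReal.inv_mul_cancel]
  obtain ⟨D, hD, hpre, hKc⟩ := exists_prefixFn_of_requests hx hn hsum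
  refine ⟨D, hD, hpre, fun χ hχ k => ?_⟩
  obtain ⟨i, hi⟩ := Set.mem_iUnion.1 ((hcover (ε k) (hε k)).1 hχ)
  have hk := hKc (Nat.pair k i)
  simp only [n, x, Nat.unpair_pair] at hk
  refine ⟨(u (ε k, i)).length, by have := hlen k i; omega, ?_⟩
  rwa [mem_Cyl_iff.1 hi]

end Criterion

/-- Levin–Schnorr criterion: `χ` is Martin-Löf random iff `KP(χ↾n) ≥ n − c`
for some constant `c` and all `n` (stated additively as `n ≤ KP(χ↾n) + c`). -/
theorem levin_schnorr_criterion
    (U : List Bool →. List Bool) (hU : OptimalPrefixDecompressor U)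
    (χ : ℕ → Bool) :
    MLRandom χ ↔
      ∃ c : ℕ, ∀ n : ℕ,
        ((n : ℕ∞)) ≤ Kc U ((List.range n).map χ) + (c : ℕ∞) := by
  obtain ⟨hpart, hpre, hopt⟩ := hU
  constructor
  · intro hχ
    by_contra! h
    refine hχ {χ} (effNull_singleton_of_compressible hpart hpre fun c => ?_) rfl
    obtain ⟨n, hn⟩ := h c
    have hlt : Kc U ((List.range n).map χ) < (n - c : ℕ) := by
      generalize Kc U ((List.range n).map χ) = m at hn
      cases m with
      | top => simp at hn
      | coe m =>
        have : m + c < n := by exact_mod_cast hn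
        exact_mod_cast (by omega : m < n - c)
    obtain ⟨p, hp, hlen⟩ := Kc_lt_iff.1 hlt
    exact ⟨n, p, hp, by omega⟩
  · rintro ⟨c, hc⟩ X hX hχ
    obtain ⟨D, hD, hDpre, hcomp⟩ := hX.exists_compressing_prefixFn
    obtain ⟨d, hd⟩ := hopt D hD hDpre
    obtain ⟨n, hkn, hK⟩ := hcomp χ hχ (c + d + 1)
    have h : (n : ℕ∞) ≤ ((n - (c + d + 1) : ℕ) : ℕ∞) + d + c :=
      (hc n).trans (add_le_add_left ((hd _).trans (add_le_add_left hK _)) _)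
    have h' : n ≤ n - (c + d + 1) + d + c := by exact_mod_cast h
    omega
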